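/- Let p be a natural number coprime to n. An n×n complex matrix M is circulant if and only if it commutes with S^p, the pth power of the circular right-shift matrix. -/

import Mathlib

/-- The circular right-shift matrix `S` on `ZMod n`, with `S i j = 1` iff `i - j = 1`. -/
def shiftRight (n : ℕ) : Matrix (ZMod n) (ZMod n) ℂ :=
  Matrix.of fun i j => if i - j = 1 then 1 else 0

theorem shiftRight_mul_apply (n : ℕ) [NeZero n] (p : ℕ) (M : Matrix (ZMod n) (ZMod n) ℂ) :
    ∀ i j, (shiftRight n ^ p * M) i j = M (i - p) j := by
  induction p with
  | zero => intro i j; simp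
  | succ p ih =>
    intro i j
    rw [pow_succ', Matrix.mul_assoc, Matrix.mul_apply, Finset.sum_eq_single (i - 1)]
    · rw [ih]
      simp [shiftRight]
      congr 1
      ring
    · intro b _ hb
      have : ¬ (i - b = 1) := fun h => hb (by rw [← h]; ring)
      simp [shiftRight, this]
    · simp

theorem mul_shiftRight_apply (n : ℕ) [NeZero n] (p : ℕ) (M : Matrix (ZMod n) (ZMod n) ℂ) :
    ∀ i j, (M * shiftRight n ^ p) i j = M i (j + p) := by
  induction p with
  | zero => intro i j; simp
  | succ p ih =>
    intro i j
    rw [pow_succ, ← Matrix.mul_assoc, Matrix.mul_apply, Finset.sum_eq_single (j + 1)]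
    · rw [ih]
      simp [shiftRight]
      congr 1
      ring
    · intro b _ hb
      have : ¬ (b - j = 1) := fun h => hb (by rw [← h]; ring)
      simp [shiftRight, this]
    · simp

/-- for `p` coprime to `n`, a matrix is circulant iff it commutes with
`S ^ p`, the `p`-th power of the circular right-shift matrix. -/
theorem circulant_iff_commute_shift_pow (n : ℕ) [NeZero n] (p : ℕ)
    (hp : Nat.Coprime p n) (M : Matrix (ZMod n) (ZMod n) ℂ) :
    (∃ x : ZMod n → ℂ, M = Matrix.circulant x) ↔
      shiftRight n ^ p * M = M * shiftRight n ^ p := by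
  constructor
  · rintro ⟨x, rfl⟩
    ext i j
    rw [shiftRight_mul_apply, mul_shiftRight_apply, Matrix.circulant_apply,
      Matrix.circulant_apply]
    congr 1
    ring
  · intro h
    have h1 : ∀ i j, M (i - p) j = M i (j + p) := fun i j => by
      rw [← shiftRight_mul_apply n p M, ← mul_shiftRight_apply n p M, h]
    have h2 : ∀ (k : ℕ) i j, M (i - k * p) j = M i (j + k * p) := by
      intro k
      induction k with
      | zero => intro i j; simp
      | succ k ih =>
        intro i j
        have e1 : i - ((k + 1 : ℕ) : ZMod n) * p = i - k * p - p := by push_cast; ring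
        have e2 : j + ((k + 1 : ℕ) : ZMod n) * p = j + p + k * p := by push_cast; ring
        rw [e1, e2, h1, ih]
    refine ⟨fun i => M i 0, ?_⟩
    ext i j
    rw [Matrix.circulant_apply]
    have hk : (((j * (p : ZMod n)⁻¹).val : ℕ) : ZMod n) * p = j := by
      rw [ZMod.natCast_zmod_val, mul_assoc, mul_comm _ (p : ZMod n),
        ZMod.coe_mul_inv_eq_one p hp, mul_one]
    have := h2 (j * (p : ZMod n)⁻¹).val i 0
    rw [hk, zero_add] at this
    exact this.symm
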